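/- For every b-matching x^W of (H_W, b^W) there exists a b-matching x of (G,b) such that ‖x‖₁ ≥ ‖x^W‖₁ − c₂^U + μ^U(0). -/

import Mathlib

open scoped Classical

/-- The degree of a vertex `v` under an edge-weight assignment `x`:
the sum of the weights of the edges of `G` incident to `v`. -/
noncomputable def bmDeg {V : Type*} [Fintype V] (G : SimpleGraph V)
    (x : Sym2 V → ℕ) (v : V) : ℕ :=
  ∑ e ∈ Finset.univ.filter (fun e : Sym2 V => e ∈ G.edgeSet ∧ v ∈ e), x e

/-- The cardinality `‖x‖₁` of an edge-weight assignment `x`. -/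
noncomputable def bmCard {V : Type*} [Fintype V] (G : SimpleGraph V)
    (x : Sym2 V → ℕ) : ℕ :=
  ∑ e ∈ Finset.univ.filter (fun e : Sym2 V => e ∈ G.edgeSet), x e

/-- `x` is a `b`-matching of `(G, b)`: it is supported on the edges of `G`
and the degree of every vertex `v` is at most `b v`. -/
def IsBMatching {V : Type*} [Fintype V] (G : SimpleGraph V) (b : V → ℕ)
    (x : Sym2 V → ℕ) : Prop :=
  (∀ e, e ∉ G.edgeSet → x e = 0) ∧ ∀ v, bmDeg G x v ≤ b v

/-- The maximum cardinality of a `b`-matching of `(G, b)`. -/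
noncomputable def maxBM {V : Type*} [Fintype V] (G : SimpleGraph V) (b : V → ℕ) : ℕ :=
  sSup {m | ∃ x, IsBMatching G b x ∧ bmCard G x = m}

/-- `mu G b w t` : the maximum cardinality of a `b`-matching of `G` when the
capacity of `w` is set to `t` and every other vertex `v` has capacity `b v`. -/
noncomputable def mu {V : Type*} [Fintype V] (G : SimpleGraph V) (b : V → ℕ)
    (w : V) (t : ℕ) : ℕ :=
  maxBM G (Function.update b w t)


/-- `(U, W)` is a split of `G`: a partition of the vertex set with both sides
of size at least `2`, such that every vertex of `U` having a neighbour in `W`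
is adjacent to every vertex of `W` having a neighbour in `U`. -/
def IsSplit {V : Type*} (G : SimpleGraph V) (U W : Set V) : Prop :=
  U ∪ W = Set.univ ∧ Disjoint U W ∧ 2 ≤ U.ncard ∧ 2 ≤ W.ncard ∧
    ∀ a ∈ U, ∀ c ∈ W, (∃ b' ∈ W, G.Adj a b') → (∃ a' ∈ U, G.Adj a' c) → G.Adj a c

/-- `splitC G U W` is the set of vertices of `U` with a neighbour in `W`
(so `splitC G U W = C = N_G(W)` and `splitC G W U = D = N_G(U)`). -/
def splitC {V : Type*} (G : SimpleGraph V) (U W : Set V) : Set V :=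
  {a | a ∈ U ∧ ∃ c ∈ W, G.Adj a c}

/-- Given a split `(U, W)` (with `C = N_G(W)`), the graph `G_U` on `U ∪ {w}`:
the induced subgraph `G[U]` together with a new split marker vertex `w`
(represented by `none`) adjacent to every vertex of `C`. -/
def sideGraph {V : Type*} (G : SimpleGraph V) (U C : Set V) :
    SimpleGraph (Option ↥U) :=
  SimpleGraph.fromRel (fun a c =>
    match a, c with
    | some a', some c' => G.Adj ↑a' ↑c'
    | some a', none => ↑a' ∈ C
    | _, _ => False)

/-- `μ^U(t)`: the maximum cardinality of a `b`-matching of `G_U` when the split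
marker vertex `w` has capacity `t` and every `v ∈ U` has capacity `b v`. -/
noncomputable def muU {V : Type*} [Fintype V] (G : SimpleGraph V) (b : V → ℕ)
    (U W : Set V) (t : ℕ) : ℕ :=
  mu (sideGraph G U (splitC G U W)) (fun a => a.elim 0 (fun v => b ↑v)) none t

/-- The auxiliary graph `H_W`, obtained from `G_W` by replacing the split marker
vertex `u` with three new vertices `u₁, u₂, u₃` (represented by `Sum.inr 0`,
`Sum.inr 1`, `Sum.inr 2`), each adjacent to every vertex of `D`, together with
the additional edge `{u₂, u₃}`. -/
def auxGraph {V : Type*} (G : SimpleGraph V) (W D : Set V) :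
    SimpleGraph (↥W ⊕ Fin 3) :=
  SimpleGraph.fromRel (fun a c =>
    match a, c with
    | Sum.inl a', Sum.inl c' => G.Adj ↑a' ↑c'
    | Sum.inl a', Sum.inr _ => ↑a' ∈ D
    | Sum.inr i, Sum.inr j => i = 1 ∧ j = 2
    | _, _ => False)

/-- The capacity function `b^W` on `H_W`: `b^W v = b v` for `v ∈ W`,
`b^W u₁ = c₁^U` and `b^W u₂ = b^W u₃ = c₂^U`. -/
def auxB {V : Type*} (W : Set V) (b : V → ℕ) (c₁ c₂ : ℕ) : ↥W ⊕ Fin 3 → ℕ :=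
  Sum.elim (fun a => b ↑a) (fun i => if i = 0 then c₁ else c₂)

section Helpers

theorem bmDeg_eq_sum {V : Type*} [Fintype V] (G : SimpleGraph V) (x : Sym2 V → ℕ)
    (hx : ∀ e, e ∉ G.edgeSet → x e = 0) (v : V) :
    bmDeg G x v = ∑ u, x s(v, u) := by
  unfold bmDeg
  symm
  have h1 : ∑ u, x s(v, u) = ∑ u ∈ Finset.univ.filter (fun u => G.Adj v u), x s(v, u) := by
    rw [Finset.sum_filter]
    refine Finset.sum_congr rfl fun u _ => ?_
    split_ifs with h
    · rfl
    · exact hx _ (by simpa using h)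
  rw [h1]
  refine Finset.sum_bij (fun u _ => s(v, u)) ?_ ?_ ?_ ?_
  · intro u hu
    simpa using hu
  · intro a _ c _ h
    exact Sym2.congr_right.1 h
  · intro e he
    simp only [Finset.mem_filter, Finset.mem_univ, true_and] at he
    obtain ⟨he, u, rfl⟩ := he
    exact ⟨u, by simpa using he, rfl⟩
  · intros; rfl

theorem bm_handshake {V : Type*} [Fintype V] (G : SimpleGraph V) (x : Sym2 V → ℕ) :
    ∑ v, bmDeg G x v = 2 * bmCard G x := by
  unfold bmDeg bmCard
  have h : ∀ v, ∑ e ∈ Finset.univ.filter (fun e : Sym2 V => e ∈ G.edgeSet ∧ v ∈ e), x e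
      = ∑ e ∈ Finset.univ.filter (fun e : Sym2 V => e ∈ G.edgeSet),
        if v ∈ e then x e else 0 := by
    intro v
    rw [← Finset.sum_filter, Finset.filter_filter]
  simp_rw [h]
  rw [Finset.sum_comm, Finset.mul_sum]
  refine Finset.sum_congr rfl fun e he => ?_
  simp only [Finset.mem_filter, Finset.mem_univ, true_and] at he
  induction e with
  | _ a c =>
    have hac : a ≠ c := G.ne_of_adj (by simpa using he)
    rw [← Finset.sum_filter]
    have : Finset.univ.filter (fun v => v ∈ s(a, c)) = {a, c} := by
      ext v; simp
    rw [this, Finset.sum_pair hac]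
    ring

theorem two_bmCard {V : Type*} [Fintype V] (G : SimpleGraph V) (x : Sym2 V → ℕ)
    (hx : ∀ e, e ∉ G.edgeSet → x e = 0) :
    2 * bmCard G x = ∑ v, ∑ u, x s(v, u) := by
  rw [← bm_handshake]
  exact Finset.sum_congr rfl fun v _ => bmDeg_eq_sum G x hx v

theorem bmDeg_update {V : Type*} [Fintype V] (G : SimpleGraph V) (x : Sym2 V → ℕ)
    (e : Sym2 V) (he : e ∈ G.edgeSet) (k : ℕ) (v : V) :
    bmDeg G (Function.update x e k) v + (if v ∈ e then x e else 0) =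
      bmDeg G x v + (if v ∈ e then k else 0) := by
  unfold bmDeg
  by_cases hv : v ∈ e
  · have hm : e ∈ Finset.univ.filter (fun e : Sym2 V => e ∈ G.edgeSet ∧ v ∈ e) := by
      simp [he, hv]
    rw [Finset.sum_update_of_mem hm, ← Finset.add_sum_erase _ x hm, Finset.sdiff_singleton_eq_erase]
    simp [hv]; ring
  · have hm : e ∉ Finset.univ.filter (fun e : Sym2 V => e ∈ G.edgeSet ∧ v ∈ e) := by
      simp [hv]
    rw [Finset.sum_update_of_notMem hm]
    simp [hv]

theorem bmCard_update {V : Type*} [Fintype V] (G : SimpleGraph V) (x : Sym2 V → ℕ)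
    (e : Sym2 V) (he : e ∈ G.edgeSet) (k : ℕ) :
    bmCard G (Function.update x e k) + x e = bmCard G x + k := by
  unfold bmCard
  have hm : e ∈ Finset.univ.filter (fun e : Sym2 V => e ∈ G.edgeSet) := by
    simp [he]
  rw [Finset.sum_update_of_mem hm, ← Finset.add_sum_erase _ x hm, Finset.sdiff_singleton_eq_erase]
  ring

theorem bm_bdd {V : Type*} [Fintype V] (G : SimpleGraph V) (b : V → ℕ) :
    BddAbove {m | ∃ x, IsBMatching G b x ∧ bmCard G x = m} := by
  refine ⟨∑ v, b v, ?_⟩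
  rintro m ⟨x, hx, rfl⟩
  have := bm_handshake G x
  have h2 : ∑ v, bmDeg G x v ≤ ∑ v, b v := Finset.sum_le_sum fun v _ => hx.2 v
  omega

theorem le_maxBM {V : Type*} [Fintype V] {G : SimpleGraph V} {b : V → ℕ} {x : Sym2 V → ℕ}
    (hx : IsBMatching G b x) : bmCard G x ≤ maxBM G b :=
  le_csSup (bm_bdd G b) ⟨x, hx, rfl⟩

theorem exists_maxBM {V : Type*} [Fintype V] (G : SimpleGraph V) (b : V → ℕ) :
    ∃ x, IsBMatching G b x ∧ bmCard G x = maxBM G b := by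
  have hne : {m | ∃ x, IsBMatching G b x ∧ bmCard G x = m}.Nonempty :=
    ⟨_, fun _ => 0, ⟨fun _ _ => rfl, fun v => by simp [bmDeg]⟩, rfl⟩
  exact Nat.sSup_mem hne (bm_bdd G b)

theorem exists_mu {V : Type*} [Fintype V] (G : SimpleGraph V) (b : V → ℕ) (w : V) (t : ℕ) :
    ∃ x : Sym2 V → ℕ, (∀ e, e ∉ G.edgeSet → x e = 0) ∧ bmDeg G x w ≤ t ∧
      (∀ v, v ≠ w → bmDeg G x v ≤ b v) ∧ bmCard G x = mu G b w t := by
  obtain ⟨x, hx, hc⟩ := exists_maxBM G (Function.update b w t)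
  refine ⟨x, hx.1, by simpa using hx.2 w, fun v hv => by simpa [hv] using hx.2 v, hc⟩

theorem mu_mono {V : Type*} [Fintype V] (G : SimpleGraph V) (b : V → ℕ) (w : V)
    {s t : ℕ} (h : s ≤ t) : mu G b w s ≤ mu G b w t := by
  obtain ⟨x, hx, hc⟩ := exists_maxBM G (Function.update b w s)
  unfold mu
  rw [← hc]
  refine le_maxBM ⟨hx.1, fun v => (hx.2 v).trans ?_⟩
  by_cases hv : v = w
  · subst hv; simpa using h
  · simp [hv]

theorem mu_succ_le {V : Type*} [Fintype V] (G : SimpleGraph V) (b : V → ℕ) (w : V)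
    (t : ℕ) : mu G b w (t + 1) ≤ mu G b w t + 1 := by
  obtain ⟨x, hx, hc⟩ := exists_maxBM G (Function.update b w (t + 1))
  unfold mu
  rw [← hc]
  by_cases hd : bmDeg G x w = 0
  · have : IsBMatching G (Function.update b w t) x := by
      refine ⟨hx.1, fun v => ?_⟩
      by_cases hv : v = w
      · subst hv; omega
      · simpa [hv] using hx.2 v
    have := le_maxBM this
    omega
  · obtain ⟨e, he, hxe⟩ := Finset.exists_ne_zero_of_sum_ne_zero hd
    simp only [Finset.mem_filter, Finset.mem_univ, true_and] at he
    have hcard := bmCard_update G x e he.1 (x e - 1)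
    have : IsBMatching G (Function.update b w t) (Function.update x e (x e - 1)) := by
      refine ⟨fun e' he' => ?_, fun v => ?_⟩
      · have : e' ≠ e := by rintro rfl; exact he' he.1
        simpa [this] using hx.1 e' he'
      · have h1 := bmDeg_update G x e he.1 (x e - 1) v
        have h2 := hx.2 v
        by_cases hv : v = w
        · subst hv
          simp [he.2] at h1 h2 ⊢
          omega
        · simp [hv] at h2 ⊢
          split_ifs at h1 <;> omega
    have := le_maxBM this
    omega

/-- Distance of two weightings. -/
def bmDist {V : Type*} [Fintype V] (x y : Sym2 V → ℕ) : ℕ :=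
  ∑ e, ((x e - y e) + (y e - x e))

theorem bmDist_update_lt {V : Type*} [Fintype V] (x y : Sym2 V → ℕ) (e : Sym2 V) (k : ℕ)
    (h : (x e - k) + (k - x e) < (x e - y e) + (y e - x e)) :
    bmDist x (Function.update y e k) < bmDist x y := by
  unfold bmDist
  refine Finset.sum_lt_sum (fun e' _ => ?_) ⟨e, Finset.mem_univ _, by simpa using h⟩
  by_cases he : e' = e
  · subst he; simpa using h.le
  · simp [he]

theorem exists_near {V : Type*} [Fintype V] (G : SimpleGraph V) (B : V → ℕ)
    (x : Sym2 V → ℕ) (hx : IsBMatching G B x) :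
    ∀ (n : ℕ) (y : Sym2 V → ℕ), bmDist x y = n → IsBMatching G B y → bmCard G x < bmCard G y →
    ∃ y', IsBMatching G B y' ∧ bmCard G y' = bmCard G x + 1 ∧
      ∀ v, bmDeg G x v ≤ bmDeg G y' v := by
  intro n
  induction n using Nat.strong_induction_on with
  | _ n ih =>
  intro y hn hy hlt
  by_cases hdeg : ∀ v, bmDeg G x v ≤ bmDeg G y v
  · by_cases hcard : bmCard G y = bmCard G x + 1
    · exact ⟨y, hy, hcard, hdeg⟩
    · obtain ⟨e, he, hxe⟩ := Finset.exists_lt_of_sum_lt hlt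
      simp only [Finset.mem_filter, Finset.mem_univ, true_and] at he
      have hc := bmCard_update G y e he (y e - 1)
      refine ih _ ?_ (Function.update y e (y e - 1)) rfl ⟨fun e' he' => ?_, fun v => ?_⟩ ?_
      · rw [← hn]; exact bmDist_update_lt _ _ _ _ (by omega)
      · have : e' ≠ e := by rintro rfl; exact he' he
        simpa [this] using hy.1 e' he'
      · have h1 := bmDeg_update G y e he (y e - 1) v
        have h2 := hy.2 v
        split_ifs at h1 <;> omega
      · omega
  · push Not at hdeg
    obtain ⟨v, hv⟩ := hdeg
    obtain ⟨e, he, hxe⟩ := Finset.exists_lt_of_sum_lt hv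
    simp only [Finset.mem_filter, Finset.mem_univ, true_and] at he
    obtain ⟨he, u, rfl⟩ := he
    set e := s(v, u) with hedef
    have huv : v ≠ u := G.ne_of_adj ((SimpleGraph.mem_edgeSet G).1 he)
    set y1 := Function.update y e (y e + 1) with hy1
    have hc1 := bmCard_update G y e he (y e + 1)
    rw [← hy1] at hc1
    have hd1 : ∀ a, bmDeg G y1 a = bmDeg G y a + if a ∈ e then 1 else 0 := by
      intro a
      have h1 := bmDeg_update G y e he (y e + 1) a
      rw [← hy1] at h1
      split_ifs at h1 ⊢ <;> omega
    have hdist : bmDist x y1 < bmDist x y := bmDist_update_lt _ _ _ _ (by omega)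
    have hs1 : ∀ e', e' ∉ G.edgeSet → y1 e' = 0 := by
      intro e' he'
      have : e' ≠ e := by rintro rfl; exact he' he
      simpa [hy1, this] using hy.1 e' he'
    have hoth : ∀ a, a ≠ u → bmDeg G y1 a ≤ B a := by
      intro a ha
      rw [hd1]
      by_cases hav : a = v
      · subst hav
        have := hx.2 a
        split_ifs <;> omega
      · have : a ∉ e := by simp [hedef, ha, hav]
        simpa [this] using hy.2 a
    by_cases hu : bmDeg G y1 u ≤ B u
    · refine ih _ (hn ▸ hdist) y1 rfl ⟨hs1, fun a => ?_⟩ (by omega)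
      by_cases ha : a = u
      · subst ha; exact hu
      · exact hoth a ha
    · have hlt2 : bmDeg G x u < bmDeg G y1 u := by
        have := hx.2 u
        omega
      obtain ⟨f, hf, hxf⟩ := Finset.exists_lt_of_sum_lt hlt2
      simp only [Finset.mem_filter, Finset.mem_univ, true_and] at hf
      have hc2 := bmCard_update G y1 f hf.1 (y1 f - 1)
      have hdist2 : bmDist x (Function.update y1 f (y1 f - 1)) < bmDist x y1 :=
        bmDist_update_lt _ _ _ _ (by omega)
      refine ih _ (hn ▸ hdist2.trans hdist) (Function.update y1 f (y1 f - 1)) rfl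
        ⟨fun e' he' => ?_, fun a => ?_⟩ (by omega)
      · have : e' ≠ f := by rintro rfl; exact he' hf.1
        simpa [this] using hs1 e' he'
      · have h1 := bmDeg_update G y1 f hf.1 (y1 f - 1) a
        by_cases ha : a = u
        · subst ha
          have h2 := hd1 a
          have h3 := hy.2 a
          simp only [hf.2, if_true] at h1
          split_ifs at h2 <;> omega
        · have := hoth a ha
          split_ifs at h1 <;> omega

theorem mu_step {V : Type*} [Fintype V] (G : SimpleGraph V) (b : V → ℕ) (w : V)
    {s t : ℕ} (hts : t ≤ s) (h : mu G b w t < mu G b w s) :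
    mu G b w t + 1 ≤ mu G b w (t + 2) := by
  obtain ⟨x, hx, hcx⟩ := exists_maxBM G (Function.update b w t)
  obtain ⟨y, hy, hcy⟩ := exists_maxBM G (Function.update b w s)
  unfold mu at h ⊢
  have hx' : IsBMatching G (Function.update b w s) x := by
    refine ⟨hx.1, fun v => (hx.2 v).trans ?_⟩
    by_cases hv : v = w
    · subst hv; simpa using hts
    · simp [hv]
  obtain ⟨z, hz, hcz, hd⟩ := exists_near G _ x hx' _ y rfl hy (by omega)
  rw [← hcx, ← hcz]
  refine le_maxBM ⟨hz.1, fun v => ?_⟩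
  by_cases hv : v = w
  · subst hv
    have h1 := bm_handshake G x
    have h2 := bm_handshake G z
    rw [← Finset.add_sum_erase _ _ (Finset.mem_univ v)] at h1 h2
    have h3 : ∑ a ∈ Finset.univ.erase v, bmDeg G x a ≤ ∑ a ∈ Finset.univ.erase v, bmDeg G z a :=
      Finset.sum_le_sum fun a _ => hd a
    have h4 := hx.2 v
    simp at h4 ⊢
    omega
  · simpa [hv] using hz.2 v

theorem exists_transport {A B : Type*} [Fintype A] [Fintype B] (r : A → ℕ) (f : B → ℕ) :
    ∀ n : ℕ, n ≤ ∑ a, r a → n ≤ ∑ c, f c →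
    ∃ z : A → B → ℕ, (∀ a, ∑ c, z a c ≤ r a) ∧ (∀ c, ∑ a, z a c ≤ f c) ∧
      ∑ a, ∑ c, z a c = n := by
  intro n
  induction n with
  | zero => intro _ _; exact ⟨fun _ _ => 0, by simp, by simp, by simp⟩
  | succ n ih =>
    intro h1 h2
    obtain ⟨z, hr, hf, hz⟩ := ih (by omega) (by omega)
    obtain ⟨a, _, ha⟩ : ∃ a ∈ Finset.univ, ∑ c, z a c < r a :=
      Finset.exists_lt_of_sum_lt (by omega)
    obtain ⟨c, _, hc⟩ : ∃ c ∈ Finset.univ, ∑ a, z a c < f c :=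
      Finset.exists_lt_of_sum_lt (by rw [Finset.sum_comm]; omega)
    refine ⟨fun a' c' => z a' c' + if a' = a then (if c' = c then 1 else 0) else 0, ?_, ?_, ?_⟩
    · intro a'
      rw [Finset.sum_add_distrib]
      have := hr a'
      by_cases h : a' = a
      · subst h; simp; omega
      · simpa [h] using this
    · intro c'
      rw [Finset.sum_add_distrib]
      have := hf c'
      by_cases h : c' = c
      · subst h; simp; omega
      · simpa [h] using this
    · simp only [Finset.sum_add_distrib]
      rw [hz]
      simp

theorem sum_split {V : Type*} [Fintype V] (U W : Set V) [Fintype U] [Fintype W]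
    (hU : U ∪ W = Set.univ) (hd : Disjoint U W) (f : V → ℕ) :
    ∑ v, f v = ∑ a : U, f a + ∑ c : W, f c := by
  rw [Finset.sum_set_coe (f := f) U, Finset.sum_set_coe (f := f) W, ← Finset.sum_union]
  · refine Finset.sum_congr ?_ fun _ _ => rfl
    ext v
    have : v ∈ U ∪ W := hU ▸ Set.mem_univ v
    simpa using this
  · rw [Set.disjoint_toFinset]; exact hd

/-- The glued weighting on pairs. -/
noncomputable def gluePair {V : Type*} (U W : Set V) (xU : Sym2 (Option U) → ℕ)
    (xW : Sym2 (W ⊕ Fin 3) → ℕ) (z : U → W → ℕ) (a c : V) : ℕ :=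
  if ha : a ∈ U then
    if hc : c ∈ U then xU s(some ⟨a, ha⟩, some ⟨c, hc⟩)
    else if hc : c ∈ W then z ⟨a, ha⟩ ⟨c, hc⟩ else 0
  else if ha : a ∈ W then
    if hc : c ∈ U then z ⟨c, hc⟩ ⟨a, ha⟩
    else if hc : c ∈ W then xW s(Sum.inl ⟨a, ha⟩, Sum.inl ⟨c, hc⟩) else 0
  else 0

theorem gluePair_symm {V : Type*} (U W : Set V) (xU : Sym2 (Option U) → ℕ)
    (xW : Sym2 (W ⊕ Fin 3) → ℕ) (z : U → W → ℕ) (a c : V) :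
    gluePair U W xU xW z a c = gluePair U W xU xW z c a := by
  unfold gluePair
  split_ifs <;> first | rfl | (rw [Sym2.eq_swap])

end Helpers

theorem glue {V : Type*} [Fintype V] (G : SimpleGraph V)
    (b : V → ℕ) (U W : Set V) (hsplit : IsSplit G U W)
    (bW : ↥W ⊕ Fin 3 → ℕ) (hbW : ∀ a : W, bW (Sum.inl a) = b a)
    (xW : Sym2 (↥W ⊕ Fin 3) → ℕ)
    (hxW : IsBMatching (auxGraph G W (splitC G W U)) bW xW) :
    ∃ x : Sym2 V → ℕ, IsBMatching G b x ∧
      bmCard G x + (∑ i, ∑ a : W, xW s(Sum.inl a, Sum.inr i)) + xW s(Sum.inr 1, Sum.inr 2)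
       = bmCard (auxGraph G W (splitC G W U)) xW
        + muU G b U W (∑ i, ∑ a : W, xW s(Sum.inl a, Sum.inr i)) := by
  obtain ⟨hUW, hdisj, -, -, hadj⟩ := hsplit
  set t := ∑ i, ∑ a : W, xW s(Sum.inl a, Sum.inr i) with ht
  unfold muU
  obtain ⟨xU, hxU1, hxUn, hxUs, hcU⟩ := exists_mu (sideGraph G U (splitC G U W))
    (fun a => a.elim 0 (fun v => b ↑v)) none t
  rw [← hcU]
  have dU := bmDeg_eq_sum _ _ hxU1
  have dW := bmDeg_eq_sum _ _ hxW.1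
  have kU := two_bmCard _ _ hxU1
  have kW := two_bmCard _ _ hxW.1
  have hr : ∑ a : U, xU s(some a, none) ≤ t := by
    have h := hxUn
    rw [dU, Fintype.sum_option] at h
    simp_rw [Sym2.eq_swap (a := some _) (b := none)]
    omega
  obtain ⟨z, hz1, hz2, hz3⟩ := exists_transport (fun a : U => xU s(some a, none))
    (fun c : W => ∑ i, xW s(Sum.inl c, Sum.inr i)) _ le_rfl (by rw [Finset.sum_comm]; exact hr)
  have hzadj : ∀ a c, z a c ≠ 0 → G.Adj a c := by
    intro a c h
    have h1 : xU s(some a, none) ≠ 0 := by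
      have := hz1 a
      have h2 := Finset.single_le_sum (f := fun c => z a c) (fun _ _ => Nat.zero_le _) (Finset.mem_univ c)
      beta_reduce at h2 this
      omega
    have h2 : ∑ i, xW s(Sum.inl c, Sum.inr i) ≠ 0 := by
      have := hz2 c
      have h2 := Finset.single_le_sum (f := fun a => z a c) (fun _ _ => Nat.zero_le _) (Finset.mem_univ a)
      beta_reduce at h2 this
      omega
    obtain ⟨i, -, hi⟩ := Finset.exists_ne_zero_of_sum_ne_zero h2
    have e1 : s(some a, none) ∈ (sideGraph G U (splitC G U W)).edgeSet := by
      by_contra hh; exact h1 (hxU1 _ hh)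
    have e2 : s(Sum.inl c, Sum.inr i) ∈ (auxGraph G W (splitC G W U)).edgeSet := by
      by_contra hh; exact hi (hxW.1 _ hh)
    simp [sideGraph, splitC] at e1
    simp [auxGraph, splitC] at e2
    obtain ⟨a', ha', h'⟩ := e2
    exact hadj a a.2 c c.2 e1 ⟨a', ha', h'.symm⟩
  have hnU : ∀ c ∈ W, c ∉ U := fun c hc hc' => Set.disjoint_left.1 hdisj hc' hc
  set p := gluePair U W xU xW z with hp
  have pUU : ∀ a c : U, p a c = xU s(some a, some c) := by intro a c; simp [hp, gluePair]
  have pUW : ∀ (a : U) (c : W), p a c = z a c := by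
    intro a c; simp [hp, gluePair, hnU c c.2]
  have pWU : ∀ (c : W) (a : U), p c a = z a c := by
    intro c a; simp [hp, gluePair, hnU c c.2]
  have pWW : ∀ a c : W, p a c = xW s(Sum.inl a, Sum.inl c) := by
    intro a c; simp [hp, gluePair, hnU c c.2, hnU a a.2]
  have hcase : ∀ v : V, (∃ a : U, v = a) ∨ ∃ c : W, v = c := by
    intro v
    rcases (hUW ▸ Set.mem_univ v : v ∈ U ∪ W) with h | h
    · exact Or.inl ⟨⟨v, h⟩, rfl⟩
    · exact Or.inr ⟨⟨v, h⟩, rfl⟩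
  let x : Sym2 V → ℕ := Sym2.lift ⟨p, gluePair_symm U W xU xW z⟩
  have hxp : ∀ a c, x s(a, c) = p a c := fun a c => rfl
  have hsupp : ∀ e, e ∉ G.edgeSet → x e = 0 := by
    intro e
    induction e with
    | _ v u =>
    intro he
    rw [hxp]
    rw [SimpleGraph.mem_edgeSet] at he
    rcases hcase v with ⟨a, rfl⟩ | ⟨a, rfl⟩ <;> rcases hcase u with ⟨c, rfl⟩ | ⟨c, rfl⟩
    · rw [pUU]
      apply hxU1
      simp [sideGraph, he, G.adj_comm c a]
    · rw [pUW]
      by_contra h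
      exact he (hzadj _ _ h)
    · rw [pWU]
      by_contra h
      exact he (hzadj _ _ h).symm
    · rw [pWW]
      apply hxW.1
      simp [auxGraph, he, G.adj_comm c a]
  have dx := bmDeg_eq_sum _ _ hsupp
  have kx := two_bmCard _ _ hsupp
  refine ⟨x, ⟨hsupp, fun v => ?_⟩, ?_⟩
  · rw [dx, sum_split U W hUW hdisj]
    simp only [hxp]
    rcases hcase v with ⟨a, rfl⟩ | ⟨a, rfl⟩
    · simp only [pUU, pUW]
      have h1 := hxUs (some a) (by simp)
      rw [dU, Fintype.sum_option] at h1
      have h2 := hz1 a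
      simp at h1 h2
      omega
    · simp only [pWU, pWW]
      have h1 := hxW.2 (Sum.inl a)
      rw [dW, Fintype.sum_sum_type, hbW] at h1
      have h2 := hz2 a
      omega
  · simp only [sum_split U W hUW hdisj, hxp, pUU, pUW, pWU, pWW, Finset.sum_add_distrib] at kx
    simp only [Fintype.sum_option, Finset.sum_add_distrib] at kU
    simp only [Fintype.sum_sum_type, Finset.sum_add_distrib] at kW
    have n0 : xU s(none, none) = 0 := hxU1 _ (by simp)
    have n1 : ∑ a : U, xU s(none, some a) = ∑ a : U, xU s(some a, none) :=
      Finset.sum_congr rfl fun a _ => by rw [Sym2.eq_swap]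
    have n2 : ∑ c : W, ∑ a : U, z a c = ∑ a : U, ∑ c : W, z a c := Finset.sum_comm
    have n3 : ∑ i : Fin 3, ∑ a : W, xW s(Sum.inr i, Sum.inl a) = t := by
      rw [ht]
      exact Finset.sum_congr rfl fun i _ => Finset.sum_congr rfl fun a _ => by rw [Sym2.eq_swap]
    have n4 : ∑ a : W, ∑ i : Fin 3, xW s(Sum.inl a, Sum.inr i) = t := Finset.sum_comm
    have n5 : ∑ i : Fin 3, ∑ j : Fin 3, xW s(Sum.inr i, Sum.inr j)
        = 2 * xW s(Sum.inr 1, Sum.inr 2) := by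
      have q : ∀ i j : Fin 3, ¬ (i = 1 ∧ j = 2) → ¬ (j = 1 ∧ i = 2) →
          xW s(Sum.inr i, Sum.inr j) = 0 := by
        intro i j h h'
        apply hxW.1
        simp only [auxGraph, SimpleGraph.mem_edgeSet, SimpleGraph.fromRel_adj]
        tauto
      simp only [Fin.sum_univ_three]
      rw [q 0 0 (by decide) (by decide), q 0 1 (by decide) (by decide),
        q 0 2 (by decide) (by decide), q 1 0 (by decide) (by decide),
        q 1 1 (by decide) (by decide), q 2 0 (by decide) (by decide),
        q 2 2 (by decide) (by decide), Sym2.eq_swap (a := Sum.inr 2)]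
      ring
    omega

/-- For every `b`-matching `x^W` of `(H_W, b^W)` there is a `b`-matching `x` of
`(G, b)` with `‖x‖₁ ≥ ‖x^W‖₁ − c₂^U + μ^U(0)`. -/
theorem aux_to_bmatching {V : Type*} [Fintype V] (G : SimpleGraph V)
    (hG : G.Connected) (b : V → ℕ) (U W : Set V) (hsplit : IsSplit G U W)
    (tmax c₁ c₂ : ℕ)
    (htmax : ∀ t : ℕ, tmax ≤ t → muU G b U W t = muU G b U W tmax)
    (htmax_least : ∀ t₀ : ℕ,
      (∀ t : ℕ, t₀ ≤ t → muU G b U W t = muU G b U W t₀) → tmax ≤ t₀)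
    (hc₁ : muU G b U W c₁ = muU G b U W 0 + c₁)
    (hc₁_max : ∀ t : ℕ, muU G b U W t = muU G b U W 0 + t → t ≤ c₁)
    (hc₂ : c₂ = (tmax - c₁) / 2)
    (xW : Sym2 (↥W ⊕ Fin 3) → ℕ)
    (hxW : IsBMatching (auxGraph G W (splitC G W U)) (auxB W b c₁ c₂) xW) :
    ∃ x : Sym2 V → ℕ,
      IsBMatching G b x ∧
      (bmCard G x : ℤ) ≥
        (bmCard (auxGraph G W (splitC G W U)) xW : ℤ) - (c₂ : ℤ) +
          (muU G b U W 0 : ℤ) := by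
  obtain ⟨x, hx, hcard⟩ := glue G b U W hsplit (auxB W b c₁ c₂) (fun a => rfl) xW hxW
  refine ⟨x, hx, ?_⟩
  have hmono : ∀ s t, s ≤ t → muU G b U W s ≤ muU G b U W t := fun s t h => mu_mono _ _ _ h
  have hsucc : ∀ t, muU G b U W (t + 1) ≤ muU G b U W t + 1 := fun t => mu_succ_le _ _ _ t
  have hstep : ∀ s t, t ≤ s → muU G b U W t < muU G b U W s →
      muU G b U W t + 1 ≤ muU G b U W (t + 2) := fun s t h h' => mu_step _ _ _ h h'
  have hk : ∀ k, k ≤ c₂ → muU G b U W 0 + c₁ + k ≤ muU G b U W (c₁ + 2 * k) := by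
    intro k
    induction k with
    | zero => intro _; simp [hc₁]
    | succ k ih =>
      intro hkc
      have h1 := ih (by omega)
      have h2 : ∃ s, c₁ + 2 * k ≤ s ∧ muU G b U W s ≠ muU G b U W (c₁ + 2 * k) := by
        by_contra hcon
        push Not at hcon
        have := htmax_least _ hcon
        omega
      obtain ⟨s, hs, hne⟩ := h2
      have h3 := hmono _ _ hs
      have h4 := hstep s _ hs (by omega)
      rw [show c₁ + 2 * (k + 1) = c₁ + 2 * k + 2 by ring]
      omega
  have hlin : ∀ d, muU G b U W c₁ ≤ muU G b U W (c₁ - d) + d := by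
    intro d
    induction d with
    | zero => simp
    | succ d ih =>
      have h1 := hsucc (c₁ - (d + 1))
      by_cases hd : d + 1 ≤ c₁
      · rw [show c₁ - (d + 1) + 1 = c₁ - d by omega] at h1
        omega
      · rw [show c₁ - (d + 1) = c₁ - d by omega]
        omega
  -- the degrees of the three auxiliary vertices
  have dW := bmDeg_eq_sum _ _ hxW.1
  have e0 := hxW.2 (Sum.inr 0)
  have e1 := hxW.2 (Sum.inr 1)
  have e2 := hxW.2 (Sum.inr 2)
  rw [dW, Fintype.sum_sum_type, Fin.sum_univ_three] at e0 e1 e2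
  simp only [auxB, Sum.elim_inr, if_true, show (1 : Fin 3) ≠ 0 by decide,
    show (2 : Fin 3) ≠ 0 by decide, if_false] at e0 e1 e2
  have sw : ∀ i : Fin 3, ∑ a : W, xW s(Sum.inr i, Sum.inl a)
      = ∑ a : W, xW s(Sum.inl a, Sum.inr i) :=
    fun i => Finset.sum_congr rfl fun a _ => by rw [Sym2.eq_swap]
  rw [sw] at e0 e1 e2
  rw [Sym2.eq_swap (a := Sum.inr 2) (b := Sum.inr 1)] at e2
  rw [Fin.sum_univ_three] at hcard
  generalize (∑ a : W, xW s(Sum.inl a, Sum.inr 0)) = f0 at *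
  generalize (∑ a : W, xW s(Sum.inl a, Sum.inr 1)) = f1 at *
  generalize (∑ a : W, xW s(Sum.inl a, Sum.inr 2)) = f2 at *
  generalize xW s(Sum.inr 1, Sum.inr 2) = y at *
  obtain ⟨m, hm1, hm2, hm3⟩ : ∃ m, m ≤ f1 ∧ m ≤ f2 ∧ f1 + f2 + y ≤ m + c₂ := by
    rcases le_total f1 f2 with h | h
    · exact ⟨f1, by omega, by omega, by omega⟩
    · exact ⟨f2, by omega, by omega, by omega⟩
  have key : muU G b U W 0 + f0 + m ≤ muU G b U W (f0 + f1 + f2) := by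
    refine le_trans ?_ (hmono (f0 + 2 * m) _ (by omega))
    by_cases hle : f0 + 2 * m ≤ c₁
    · have := hlin (c₁ - (f0 + 2 * m))
      rw [show c₁ - (c₁ - (f0 + 2 * m)) = f0 + 2 * m by omega] at this
      omega
    · have h1 := hk ((f0 + 2 * m - c₁) / 2) (by omega)
      have h2 := hmono (c₁ + 2 * ((f0 + 2 * m - c₁) / 2)) (f0 + 2 * m) (by omega)
      omega
  omega
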